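/- arXiv:2110.15496 — 7 statements merged into one kernel-verified Lean document; each statement's English description precedes it below -/
import Mathlib

section
/- Let X be a Tychonoff (completely regular Hausdorff) topological space of countable pseudocharacter (every singleton of X is a G_δ-set), and let A = {a_i : i ∈ ℕ} be a countable strongly Coz_δ-disjoint subset of X. Then the family of singletons {{a_i} : i ∈ ℕ} is completely Coz_δ-additive. -/
open Set Topology Filter

/-- A real-valued function on a topological space is *Baire-one* if it is the
pointwise limit of a sequence of continuous real-valued functions. -/
def BaireOne {X : Type*} [TopologicalSpace X] (f : X → ℝ) : Prop :=
  ∃ g : ℕ → X → ℝ, (∀ n, Continuous (g n)) ∧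
    ∀ x, Filter.Tendsto (fun n => g n x) Filter.atTop (nhds (f x))

/-- A *zero-set* is the preimage of `{0}` under a continuous real-valued function. -/
def IsZeroSet {X : Type*} [TopologicalSpace X] (s : Set X) : Prop :=
  ∃ f : X → ℝ, Continuous f ∧ s = f ⁻¹' {0}

/-- A *cozero-set* is the complement of a zero-set. -/
def IsCozeroSet {X : Type*} [TopologicalSpace X] (s : Set X) : Prop :=
  IsZeroSet sᶜ

/-- A *Coz_δ-set* is a countable intersection of cozero-sets. -/
def IsCozDelta {X : Type*} [TopologicalSpace X] (s : Set X) : Prop :=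
  ∃ F : ℕ → Set X, (∀ n, IsCozeroSet (F n)) ∧ s = ⋂ n, F n

/-- A *Zer_σ-set* is a countable union of zero-sets. -/
def IsZerSigma {X : Type*} [TopologicalSpace X] (s : Set X) : Prop :=
  ∃ F : ℕ → Set X, (∀ n, IsZeroSet (F n)) ∧ s = ⋃ n, F n

/-- A family of Coz_δ-subsets is *completely Coz_δ-additive* if the union of every
subfamily is a Coz_δ-set. -/
def CompletelyCozDeltaAdditive {X : Type*} [TopologicalSpace X] {ι : Type*}
    (F : ι → Set X) : Prop :=
  (∀ i, IsCozDelta (F i)) ∧ ∀ S : Set ι, IsCozDelta (⋃ i ∈ S, F i)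

/-- A set `A ⊆ X` is *strongly Coz_δ-disjoint* if there is a pairwise disjoint,
completely Coz_δ-additive family of Coz_δ-sets `F a` with `a ∈ F a` for every `a ∈ A`. -/
def StronglyCozDeltaDisjoint {X : Type*} [TopologicalSpace X] (A : Set X) : Prop :=
  ∃ F : A → Set X, (∀ a : A, (a : X) ∈ F a) ∧
    (Pairwise fun a b : A => Disjoint (F a) (F b)) ∧
    CompletelyCozDeltaAdditive F

theorem IsZeroSet.inter {X : Type*} [TopologicalSpace X] {s t : Set X}
    (hs : IsZeroSet s) (ht : IsZeroSet t) : IsZeroSet (s ∩ t) := by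
  obtain ⟨f, hf, rfl⟩ := hs
  obtain ⟨g, hg, rfl⟩ := ht
  refine ⟨fun x => |f x| + |g x|, hf.abs.add hg.abs, ?_⟩
  ext x
  simp [add_eq_zero_iff_of_nonneg (abs_nonneg (f x)) (abs_nonneg (g x))]

theorem IsCozeroSet.union {X : Type*} [TopologicalSpace X] {s t : Set X}
    (hs : IsCozeroSet s) (ht : IsCozeroSet t) : IsCozeroSet (s ∪ t) := by
  rw [IsCozeroSet, compl_union]
  exact IsZeroSet.inter hs ht

theorem isCozeroSet_empty {X : Type*} [TopologicalSpace X] : IsCozeroSet (∅ : Set X) :=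
  ⟨fun _ => 0, continuous_const, by simp⟩

theorem isCozDelta_iInter_of_isCozeroSet {X ι : Type*} [TopologicalSpace X] [Countable ι]
    [Nonempty ι] {F : ι → Set X} (hF : ∀ i, IsCozeroSet (F i)) : IsCozDelta (⋂ i, F i) := by
  obtain ⟨e, he⟩ := exists_surjective_nat ι
  exact ⟨F ∘ e, fun n => hF (e n), (he.iInter_comp F).symm⟩

theorem isCozDelta_iInter {X : Type*} [TopologicalSpace X] {F : ℕ → Set X}
    (hF : ∀ n, IsCozDelta (F n)) : IsCozDelta (⋂ n, F n) := by
  choose G hG hFG using hF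
  have h : ⋂ n, F n = ⋂ p : ℕ × ℕ, G p.1 p.2 := by
    ext x
    simp [hFG]
  rw [h]
  exact isCozDelta_iInter_of_isCozeroSet fun p => hG p.1 p.2

theorem IsCozDelta.union {X : Type*} [TopologicalSpace X] {s t : Set X}
    (hs : IsCozDelta s) (ht : IsCozDelta t) : IsCozDelta (s ∪ t) := by
  obtain ⟨F, hF, rfl⟩ := hs
  obtain ⟨G, hG, rfl⟩ := ht
  have h : (⋂ n, F n) ∪ (⋂ n, G n) = ⋂ p : ℕ × ℕ, F p.1 ∪ G p.2 := by
    ext x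
    simp only [mem_union, mem_iInter, Prod.forall, forall_or_left, forall_or_right]
  rw [h]
  exact isCozDelta_iInter_of_isCozeroSet fun p => (hF p.1).union (hG p.2)

theorem isCozDelta_empty {X : Type*} [TopologicalSpace X] : IsCozDelta (∅ : Set X) :=
  ⟨fun _ => ∅, fun _ => isCozeroSet_empty, (iInter_const ∅).symm⟩

theorem Set.Finite.isCozDelta_biUnion {X ι : Type*} [TopologicalSpace X] {s : Set ι}
    (hs : s.Finite) {F : ι → Set X} (hF : ∀ i, IsCozDelta (F i)) :
    IsCozDelta (⋃ i ∈ s, F i) := by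
  induction s, hs using Set.Finite.induction_on with
  | empty => simpa using isCozDelta_empty
  | insert _ _ ih =>
    rw [biUnion_insert]
    exact (hF _).union ih

theorem exists_isCozeroSet_subset {X : Type*} [TopologicalSpace X] [CompletelyRegularSpace X]
    {x : X} {U : Set X} (hU : IsOpen U) (hx : x ∈ U) :
    ∃ V, IsCozeroSet V ∧ x ∈ V ∧ V ⊆ U := by
  obtain ⟨f, hf, hfx, hfU⟩ :=
    CompletelyRegularSpace.completely_regular x Uᶜ hU.isClosed_compl (not_not.2 hx)
  refine ⟨{y | (f y : ℝ) - 1 ≠ 0}, ⟨fun y => (f y : ℝ) - 1, by fun_prop, ?_⟩, ?_, ?_⟩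
  · ext y
    simp
  · simp [hfx]
  · intro y hy
    by_contra hyU
    exact hy (by simp [hfU hyU])

theorem isCozDelta_singleton {X : Type*} [TopologicalSpace X] [CompletelyRegularSpace X]
    {x : X} (hx : IsGδ ({x} : Set X)) : IsCozDelta ({x} : Set X) := by
  obtain ⟨U, hU, hxU⟩ := hx.eq_iInter_nat
  have hmem : ∀ n, x ∈ U n := mem_iInter.1 (hxU ▸ mem_singleton x)
  choose V hV hxV hVU using fun n => exists_isCozeroSet_subset (hU n) (hmem n)
  refine ⟨V, hV, Subset.antisymm (singleton_subset_iff.2 (mem_iInter.2 hxV)) ?_⟩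
  rw [hxU]
  exact iInter_mono hVU

/-- Let `X` be a Tychonoff space of countable pseudocharacter (every
singleton is Gδ) and `A ⊆ X` a countable strongly Coz_δ-disjoint subset. Then the family
of singletons `{a}`, `a ∈ A`, is completely Coz_δ-additive. -/
theorem statement10 {X : Type*} [TopologicalSpace X] [T35Space X]
    (hψ : ∀ x : X, IsGδ ({x} : Set X))
    (A : Set X) (hA : A.Countable) (hstr : StronglyCozDeltaDisjoint A) :
    CompletelyCozDeltaAdditive (fun a : A => ({(a : X)} : Set X)) := by
  classical
  obtain ⟨F, hmem, hdisj, -, hadd⟩ := hstr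
  have hsing : ∀ a : A, IsCozDelta ({(a : X)} : Set X) := fun a => isCozDelta_singleton (hψ a)
  refine ⟨hsing, fun S => ?_⟩
  have := hA.to_subtype
  obtain ⟨e, he⟩ := exists_injective_nat A
  -- Replace all but the first `n` singletons by the corresponding sets of the disjoint family.
  have h : (⋃ a ∈ S, ({(a : X)} : Set X)) =
      ⋂ n, ((⋃ a ∈ {a ∈ S | e a < n}, ({(a : X)} : Set X)) ∪ ⋃ a ∈ {a ∈ S | n ≤ e a}, F a) := by
    ext x
    simp only [mem_iUnion, mem_singleton_iff, exists_prop, mem_iInter, mem_union, mem_ofPred_eq]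
    constructor
    · rintro ⟨a, ha, rfl⟩ n
      rcases lt_or_ge (e a) n with hn | hn
      · exact Or.inl ⟨a, ⟨ha, hn⟩, rfl⟩
      · exact Or.inr ⟨a, ⟨ha, hn⟩, hmem a⟩
    · intro hx
      rcases hx 0 with ⟨a, ⟨ha, -⟩, hxa⟩ | ⟨a, -, hxa⟩
      · exact ⟨a, ha, hxa⟩
      rcases hx (e a + 1) with ⟨b, ⟨hb, -⟩, hxb⟩ | ⟨b, ⟨-, hab⟩, hxb⟩
      · exact ⟨b, hb, hxb⟩
      · have hne : a ≠ b := by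
          rintro rfl
          omega
        exact (disjoint_left.1 (hdisj hne) hxa hxb).elim
  rw [h]
  refine isCozDelta_iInter fun n => IsCozDelta.union ?_ (hadd _)
  have hfin : {a ∈ S | e a < n}.Finite :=
    ((finite_Iio n).preimage he.injOn).subset fun a ha => ha.2
  exact hfin.isCozDelta_biUnion hsing
end

section
/- Let X be a Tychonoff (completely regular Hausdorff) topological space of countable pseudocharacter. Then B_1(X) is a Baire space if and only if every pairwise disjoint sequence {Δ_i : i ∈ ℕ} of nonempty finite subsets of X has a subsequence {Δ_{i_k} : k ∈ ℕ} such that ∪_{k∈ℕ} Δ_{i_k} is a G_δ-set in X. -/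
open Set Topology Filter

theorem exists_bump {X : Type*} [TopologicalSpace X] [T35Space X] (F : Finset X) {U : Set X}
    (hU : IsOpen U) {a : X} (ha : a ∈ U) :
    ∃ e : BoundedContinuousFunction X ℝ, e a = 1 ∧ (∀ b ∈ F, b ≠ a → e b = 0) ∧
      ∀ x ∉ U, e x = 0 := by
  classical
  have hK : IsClosed (Uᶜ ∪ ((F.erase a : Finset X) : Set X)) :=
    hU.isClosed_compl.union (F.erase a).finite_toSet.isClosed
  obtain ⟨f, hf, hfa, hfK⟩ := CompletelyRegularSpace.completely_regular a _ hK (by simp [ha])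
  refine ⟨BoundedContinuousFunction.ofNormedAddCommGroup (fun x => 1 - (f x : ℝ))
    (by fun_prop) 1 fun x => ?_, ?_, fun b hb hba => ?_, fun x hx => ?_⟩
  · rw [Real.norm_eq_abs, abs_le]
    constructor <;> linarith [(f x).2.1, (f x).2.2]
  · simp [hfa]
  · have := hfK (show b ∈ _ from Or.inr (by simp [hb, hba]))
    simp [this]
  · have := hfK (show x ∈ _ from Or.inl hx)
    simp [this]

theorem exists_interpolation {X : Type*} [TopologicalSpace X] [T35Space X] (F : Finset X)
    {U : Set X} (hU : IsOpen U) (hF : (F : Set X) ⊆ U) (y : X → ℝ) :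
    ∃ g : BoundedContinuousFunction X ℝ, (∀ a ∈ F, g a = y a) ∧ ∀ x ∉ U, g x = 0 := by
  classical
  choose! e he1 he0 heU using fun a (ha : a ∈ F) => exists_bump F hU (hF ha)
  refine ⟨∑ a ∈ F, y a • e a, fun b hb => ?_, fun x hx => ?_⟩
  · rw [BoundedContinuousFunction.sum_apply, Finset.sum_eq_single b]
    · simp [he1 b hb]
    · intro a ha hab
      simp [he0 a ha b hb hab.symm]
    · exact fun h => absurd hb h
  · rw [BoundedContinuousFunction.sum_apply]
    refine Finset.sum_eq_zero fun a ha => ?_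
    simp [heU a ha x hx]

theorem BaireOne.of_continuous {X : Type*} [TopologicalSpace X] {f : X → ℝ}
    (hf : Continuous f) : BaireOne f :=
  ⟨fun _ => f, fun _ => hf, fun _ => tendsto_const_nhds⟩

theorem BaireOne.comp_continuous {X : Type*} [TopologicalSpace X] {f : X → ℝ}
    (hf : BaireOne f) {h : ℝ → ℝ} (hh : Continuous h) : BaireOne fun x => h (f x) := by
  obtain ⟨g, hg, hgf⟩ := hf
  exact ⟨fun n x => h (g n x), fun n => hh.comp (hg n), fun x => (hh.tendsto _).comp (hgf x)⟩

theorem BaireOne.isGδ_setOf_le {X : Type*} [TopologicalSpace X] {f : X → ℝ}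
    (hf : BaireOne f) (c : ℝ) : IsGδ {x | f x ≤ c} := by
  obtain ⟨g, hg, hgf⟩ := hf
  have : {x | f x ≤ c} =
      ⋂ m : ℕ, ⋂ N : ℕ, ⋃ n ≥ N, {x | g n x < c + 1 / ((m : ℝ) + 1)} := by
    ext x
    simp only [mem_ofPred_eq, mem_iInter, mem_iUnion, exists_prop]
    constructor
    · intro h m N
      have hpos : (0 : ℝ) < 1 / ((m : ℝ) + 1) := Nat.one_div_pos_of_nat
      obtain ⟨n, hn⟩ := (((hgf x).eventually_lt_const
        (show f x < c + 1 / ((m : ℝ) + 1) by linarith)).and (eventually_ge_atTop N)).exists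
      exact ⟨n, hn.2, hn.1⟩
    · intro h
      by_contra! hc
      obtain ⟨m, hm⟩ := exists_nat_one_div_lt (sub_pos.2 hc)
      obtain ⟨N, hN⟩ := eventually_atTop.1 ((hgf x).eventually_const_lt
        (show c + 1 / ((m : ℝ) + 1) < f x by linarith))
      obtain ⟨n, hn, hlt⟩ := h m N
      exact absurd hlt (hN n hn).not_gt
  rw [this]
  refine .iInter fun m => .iInter fun N => IsOpen.isGδ ?_
  exact isOpen_biUnion fun n _ => isOpen_lt (hg n) continuous_const

open scoped Classical in
/-- Modifying a continuous function arbitrarily on a countable Gδ-set gives a Baire-one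
function. -/
theorem BaireOne.piecewise_of_countable_isGδ {X : Type*} [TopologicalSpace X] [T35Space X]
    {B : Set X} (hB : B.Countable) (hBG : IsGδ B) (h : X → ℝ) {g : X → ℝ} (hg : Continuous g) :
    BaireOne (B.piecewise h g) := by
  rcases B.eq_empty_or_nonempty with rfl | hne
  · simpa using BaireOne.of_continuous hg
  obtain ⟨b, rfl⟩ := hB.exists_eq_range hne
  obtain ⟨U, hU, hBU⟩ := hBG.eq_iInter_nat
  have key : ∀ n : ℕ, ∃ e : BoundedContinuousFunction X ℝ,
      (∀ a ∈ (Finset.range (n + 1)).image b, e a = h a - g a) ∧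
        ∀ x ∉ ⋂ m ∈ Finset.range (n + 1), U m, e x = 0 := by
    intro n
    refine exists_interpolation _ (isOpen_biInter_finset fun m _ => hU m) ?_ (fun x => h x - g x)
    intro x hx
    obtain ⟨i, -, rfl⟩ := Finset.mem_image.1 (Finset.mem_coe.1 hx)
    have : b i ∈ ⋂ n, U n := hBU ▸ mem_range_self i
    exact mem_iInter₂.2 fun m _ => mem_iInter.1 this m
  choose e he heU using key
  refine ⟨fun n x => g x + e n x, fun n => hg.add (e n).continuous, fun x => ?_⟩
  by_cases hx : x ∈ range b
  · obtain ⟨i, rfl⟩ := hx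
    refine tendsto_const_nhds.congr' (eventually_atTop.2 ⟨i, fun n hn => ?_⟩)
    beta_reduce
    rw [piecewise_eq_of_mem _ _ _ (mem_range_self i),
      he n (b i) (Finset.mem_image_of_mem _ (by simp; omega))]
    ring
  · have hx' := hx
    rw [hBU] at hx'
    obtain ⟨m, hm⟩ := by simpa using hx'
    refine tendsto_const_nhds.congr' (eventually_atTop.2 ⟨m, fun n hn => ?_⟩)
    beta_reduce
    rw [piecewise_eq_of_notMem _ _ _ hx, heU n x, add_zero]
    simp only [mem_iInter, not_forall]
    exact ⟨m, by simp; omega, hm⟩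

theorem exists_finset_forall_eqOn_mem {ι : Type*} {O : Set (ι → ℝ)} (hO : IsOpen O)
    {z : ι → ℝ} (hz : z ∈ O) : ∃ F : Finset ι, ∀ w : ι → ℝ, (∀ a ∈ F, w a = z a) → w ∈ O := by
  obtain ⟨F, u, hu, huQ⟩ := isOpen_pi_iff.1 hO z hz
  exact ⟨F, fun w hw => huQ fun a ha => by rw [hw a ha]; exact (hu a ha).2⟩

theorem exists_continuous_mem {X : Type*} [TopologicalSpace X] [T35Space X]
    {O : Set (X → ℝ)} (hO : IsOpen O) (hne : O.Nonempty) :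
    ∃ f : X → ℝ, Continuous f ∧ f ∈ O := by
  obtain ⟨z, hz⟩ := hne
  obtain ⟨F, hF⟩ := exists_finset_forall_eqOn_mem hO hz
  obtain ⟨g, hg, -⟩ := exists_interpolation F isOpen_univ (subset_univ _) z
  exact ⟨g, g.continuous, hF _ hg⟩

theorem exists_subsequence_isGδ_of_baireSpace {X : Type*} [TopologicalSpace X] [T35Space X]
    (hψ : ∀ x : X, IsGδ ({x} : Set X)) [BaireSpace {f : X → ℝ // BaireOne f}]
    (Δ : ℕ → Set X) (hfin : ∀ i, (Δ i).Finite)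
    (hdisj : Pairwise fun i j => Disjoint (Δ i) (Δ j)) :
    ∃ φ : ℕ → ℕ, StrictMono φ ∧ IsGδ (⋃ k, Δ (φ k)) := by
  classical
  let W : ℕ → Set (X → ℝ) := fun n => ⋃ i ≥ n, ⋂ x ∈ Δ i, {z | |z x - i| < 1 / 4}
  have hWo : ∀ n, IsOpen (W n) := fun n => isOpen_biUnion fun i _ =>
    (hfin i).isOpen_biInter fun x _ => isOpen_lt (by fun_prop) continuous_const
  have hWd : ∀ n, Dense (Subtype.val ⁻¹' W n : Set {f : X → ℝ // BaireOne f}) := by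
    intro n
    refine dense_iff_inter_open.2 fun O hO ⟨f, hf⟩ => ?_
    obtain ⟨O', hO', rfl⟩ := isOpen_induced_iff.1 hO
    obtain ⟨F, hF⟩ := exists_finset_forall_eqOn_mem hO' hf
    have hbad : {i | (Δ i ∩ F).Nonempty}.Finite := by
      refine (F.finite_toSet.biUnion (t := fun x => {i | x ∈ Δ i}) fun x _ =>
        Set.Subsingleton.finite fun i hi j hj => ?_).subset
          fun i ⟨x, hx, hxF⟩ => mem_iUnion₂.2 ⟨x, hxF, hx⟩
      by_contra hne
      exact Set.disjoint_left.1 (hdisj hne) hi hj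
    obtain ⟨i, hi, hin⟩ := hbad.infinite_compl.exists_gt n
    obtain ⟨g, hg, -⟩ := exists_interpolation (F ∪ (hfin i).toFinset) isOpen_univ
      (subset_univ _) (fun x => if x ∈ F then f.1 x else i)
    refine ⟨⟨g, .of_continuous g.continuous⟩, hF _ fun a ha => ?_, ?_⟩
    · simp [hg a (by simp [ha]), ha]
    · refine mem_iUnion₂.2 ⟨i, hin.le, mem_iInter₂.2 fun x hx => ?_⟩
      have hxF : x ∉ F := fun h => hi ⟨x, hx, h⟩
      simp [hg x (by simp [hx]), hxF]
  have : Nonempty {f : X → ℝ // BaireOne f} := ⟨⟨0, .of_continuous continuous_const⟩⟩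
  obtain ⟨⟨f, hf⟩, hfW⟩ := (dense_iInter_of_isOpen
    (fun n => (hWo n).preimage continuous_subtype_val) hWd).nonempty
  have hfreq : ∃ᶠ i in atTop, ∀ x ∈ Δ i, |f x - i| < 1 / 4 := by
    refine frequently_atTop.2 fun n => ?_
    obtain ⟨i, hi, h⟩ := mem_iUnion₂.1 (mem_iInter.1 hfW n)
    exact ⟨i, hi, fun x hx => mem_iInter₂.1 h x hx⟩
  obtain ⟨φ, hφ, hfφ⟩ := extraction_of_frequently_atTop hfreq
  refine ⟨φ, hφ, ?_⟩
  let R : Set ℝ := range fun k => (φ k : ℝ)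
  have hR : R.Nonempty := range_nonempty _
  have heq : (⋃ k, Δ (φ k)) = {x | Metric.infDist (f x) R ≤ 1 / 4} ∩
      ⋂ k, ({x | - |f x - φ k| ≤ - (1 / 2)} ∪ Δ (φ k)) := by
    ext x
    simp only [mem_iUnion, mem_inter_iff, mem_ofPred_eq, mem_iInter, mem_union]
    constructor
    · rintro ⟨k, hk⟩
      have h1 := hfφ k x hk
      refine ⟨(Metric.infDist_le_dist_of_mem (mem_range_self k)).trans h1.le, fun j => ?_⟩
      by_cases hj : 1 / 2 ≤ |f x - φ j|
      · exact Or.inl (by linarith)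
      · right
        have h2 : |(φ j : ℝ) - φ k| < 1 := by
          have := abs_sub_le (φ j : ℝ) (f x) (φ k)
          rw [abs_sub_comm _ (f x)] at this
          linarith
        have h3 : φ j = φ k := by
          have : |(φ j : ℤ) - φ k| < 1 := by exact_mod_cast h2
          have := Int.abs_lt_one_iff.1 this
          omega
        rwa [h3]
    · rintro ⟨h1, h2⟩
      obtain ⟨_, ⟨k, rfl⟩, hk⟩ := (Metric.infDist_lt_iff hR).1
        (h1.trans_lt (show (1 / 4 : ℝ) < 1 / 2 by norm_num))
      rw [Real.dist_eq] at hk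
      exact ⟨k, (h2 k).resolve_left (by linarith)⟩
  rw [heq]
  refine ((hf.comp_continuous (Metric.continuous_infDist_pt R)).isGδ_setOf_le _).inter
    (.iInter fun k => .union ((hf.comp_continuous
      (h := fun y => - |y - φ k|) (by fun_prop)).isGδ_setOf_le _) ?_)
  rw [← biUnion_of_singleton (Δ (φ k))]
  exact .biUnion (hfin _) fun x _ => hψ x

theorem exists_domRestrict_eq {X : Type*} (S : Set X) (y : S → ℝ) :
    ∃ z : X → ℝ, S.domRestrict z = y := by
  classical
  exact ⟨fun x => if h : x ∈ S then y ⟨x, h⟩ else 0, by ext a; simp⟩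

theorem exists_countable_witness {X : Type*} {U : ℕ → Set (X → ℝ)} (hUo : ∀ n, IsOpen (U n))
    (hUd : ∀ n, Dense (U n)) {S : Set X} (hS : S.Countable) :
    ∃ T : Set X, T.Countable ∧ S ⊆ T ∧ ∀ n, ∀ O : Set (S → ℝ), IsOpen O → O.Nonempty →
      ∃ z : X → ℝ, S.domRestrict z ∈ O ∧ ∃ E : Finset X, (E : Set X) ⊆ T ∧ ∃ u : X → Set ℝ,
        (∀ x ∈ E, IsOpen (u x) ∧ z x ∈ u x) ∧ (E : Set X).pi u ⊆ U n := by
  have : Countable S := hS.to_subtype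
  let b := TopologicalSpace.countableBasis (S → ℝ)
  have : Countable b := (TopologicalSpace.countable_countableBasis _).to_subtype
  have key : ∀ (n : ℕ) (O : b), ∃ z : X → ℝ, S.domRestrict z ∈ O.1 ∧ ∃ E : Finset X,
      ∃ u : X → Set ℝ, (∀ x ∈ E, IsOpen (u x) ∧ z x ∈ u x) ∧ (E : Set X).pi u ⊆ U n := by
    intro n O
    obtain ⟨y, hy⟩ := TopologicalSpace.nonempty_of_mem_countableBasis O.2
    have hO : IsOpen (S.domRestrict ⁻¹' O.1 : Set (X → ℝ)) :=
      (TopologicalSpace.isOpen_of_mem_countableBasis O.2).preimage (Pi.continuous_domRestrict S)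
    obtain ⟨y', hy'⟩ := exists_domRestrict_eq S y
    obtain ⟨z, hzO, hzU⟩ := (hUd n).inter_open_nonempty _ hO ⟨y', by simpa [hy'] using hy⟩
    exact ⟨z, hzO, isOpen_pi_iff.1 (hUo n) z hzU⟩
  choose z hz E u hu huU using key
  refine ⟨S ∪ ⋃ n, ⋃ O : b, (E n O : Set X),
    hS.union (countable_iUnion fun n => countable_iUnion fun O => (E n O).countable_toSet),
    subset_union_left, fun n O hO ⟨y, hy⟩ => ?_⟩
  obtain ⟨O', hO', -, hOO⟩ := (TopologicalSpace.isBasis_countableBasis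
    (S → ℝ)).exists_subset_of_mem_open hy hO
  refine ⟨z n ⟨O', hO'⟩, hOO (hz n ⟨O', hO'⟩), E n ⟨O', hO'⟩, ?_, u n ⟨O', hO'⟩,
    hu n ⟨O', hO'⟩, huU n ⟨O', hO'⟩⟩
  exact fun x hx => Or.inr (mem_iUnion₂.2 ⟨n, ⟨O', hO'⟩, hx⟩)

/-- Countably many dense open subsets of `X → ℝ` contain dense open sets depending on a common
countable set of coordinates. -/
theorem exists_countable_support {X : Type*} {U : ℕ → Set (X → ℝ)} (hUo : ∀ n, IsOpen (U n))
    (hUd : ∀ n, Dense (U n)) {K : Set X} (hK : K.Countable) :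
    ∃ A : Set X, A.Countable ∧ K ⊆ A ∧ ∃ V : ℕ → Set (A → ℝ),
      (∀ n, IsOpen (V n)) ∧ (∀ n, Dense (V n)) ∧
        ∀ n, ∀ z : X → ℝ, A.domRestrict z ∈ V n → z ∈ U n := by
  choose T hTc hTS hT using fun S : {S : Set X // S.Countable} =>
    exists_countable_witness hUo hUd S.2
  let C : ℕ → {S : Set X // S.Countable} :=
    fun n => Nat.rec ⟨K, hK⟩ (fun _ S => ⟨T S, hTc S⟩) n
  have hC : Monotone fun n => (C n).1 := monotone_nat_of_le_succ fun n => hTS (C n)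
  refine ⟨⋃ n, (C n).1, countable_iUnion fun n => (C n).2,
    subset_iUnion (fun n => (C n).1) 0,
    fun n => interior {y | ∀ z : X → ℝ, (⋃ n, (C n).1).domRestrict z = y → z ∈ U n},
    fun n => isOpen_interior, fun n => ?_, fun n z hz => interior_subset hz z rfl⟩
  refine dense_iff_inter_open.2 fun O hO ⟨y, hy⟩ => ?_
  obtain ⟨F, w, hw, hwO⟩ := isOpen_pi_iff.1 hO y hy
  obtain ⟨k, hk⟩ : ∃ k, ∀ a ∈ F, a.1 ∈ (C k).1 := by
    choose j hj using fun a : ↥(⋃ n, (C n).1) => mem_iUnion.1 a.2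
    exact ⟨F.sup j, fun a ha => hC (Finset.le_sup ha) (hj a)⟩
  let r : ((C k).1 : Set X) → ↥(⋃ n, (C n).1) := fun a => ⟨a.1, mem_iUnion.2 ⟨k, a.2⟩⟩
  obtain ⟨z, hz, E, hET, u, hu, huU⟩ := hT (C k) n
    (⋂ a ∈ F, {y' | ∀ h : a.1 ∈ (C k).1, y' ⟨a.1, h⟩ ∈ w a})
    (isOpen_biInter_finset fun a ha => by
      simp only [hk a ha, forall_true_left]
      exact (hw a ha).1.preimage (continuous_apply _))
    ⟨fun a => y (r a), mem_iInter₂.2 fun a ha h => (hw a ha).2⟩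
  have hEA : ∀ x ∈ E, x ∈ ⋃ n, (C n).1 := fun x hx => mem_iUnion.2 ⟨k + 1, hET hx⟩
  refine ⟨(⋃ n, (C n).1).domRestrict z, hwO fun a ha => ?_, mem_interior.2
    ⟨⋂ x : E, {y' | y' ⟨x.1, hEA x x.2⟩ ∈ u x}, ?_, ?_, ?_⟩⟩
  · exact mem_iInter₂.1 hz a ha (hk a ha)
  · rintro y' hy' z' rfl
    exact huU fun x hx => mem_iInter.1 hy' ⟨x, hx⟩
  · exact isOpen_iInter_of_finite fun x => (hu x x.2).1.preimage (continuous_apply _)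
  · exact mem_iInter.2 fun x => (hu x x.2).2

open scoped Classical in
/-- The set of pairs `(g, v)` such that the function equal to `g` on the finite set `F` and to
`v` elsewhere belongs to a given dense set is dense. -/
theorem dense_setOf_ite_mem {X : Type*} [TopologicalSpace X] [T35Space X] {A : Set X}
    {V : Set (A → ℝ)} (hV : Dense V) (F : Finset A) :
    Dense {p : BoundedContinuousFunction X ℝ × (A → ℝ) |
      (fun a => if a ∈ F then p.1 a else p.2 a) ∈ V} := by
  rintro ⟨g, v⟩
  choose e he1 he0 _ using fun a : A =>
    exists_bump (F.map (.subtype _)) isOpen_univ (mem_univ a.1)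
  let y : A → ℝ := fun a => if a ∈ F then g a else v a
  let Ψ : (A → ℝ) → BoundedContinuousFunction X ℝ × (A → ℝ) := fun w =>
    (g + ∑ a ∈ F, (w a - y a) • e a, v + (w - y))
  have hΨ : Continuous Ψ := by
    refine .prodMk (continuous_const.add (continuous_finsetSum _ fun a _ => ?_)) (by fun_prop)
    exact ((continuous_apply a).sub continuous_const).smul continuous_const
  have hy : Ψ y = (g, v) := by simp [Ψ]
  rw [← hy]
  refine closure_mono ?_ (image_closure_subset_closure_image hΨ ⟨y, hV y, rfl⟩)
  rintro _ ⟨w, hw, rfl⟩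
  rw [mem_ofPred_eq]
  convert hw using 1
  ext a
  by_cases ha : a ∈ F
  · have : (∑ b ∈ F, (w b - y b) • e b) a.1 = w a - y a := by
      rw [BoundedContinuousFunction.sum_apply, Finset.sum_eq_single a]
      · simp [he1]
      · intro b _ hba
        simp [he0 b a.1 (by simpa using ha) (fun h => hba (Subtype.ext h).symm)]
      · exact fun h => absurd ha h
    simp only [ha, if_true, Ψ, BoundedContinuousFunction.add_apply, this]
    simp [y, ha]
  · simp [ha, Ψ, y]

theorem exists_ssubset_absorbing {α : Type*} [Infinite α] (E : ℕ → Finset α → Finset α) :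
    ∃ S : ℕ → Finset α, (∀ n, S n ⊂ S (n + 1)) ∧ ∀ n, ∀ F ⊆ S n, E n F ⊆ S (n + 1) := by
  classical
  choose p hp using fun S : Finset α => Infinite.exists_notMem_finset S
  let S : ℕ → Finset α := fun n =>
    Nat.rec ∅ (fun n T => insert (p T) (T ∪ T.powerset.biUnion (E n))) n
  have hS : ∀ n, S (n + 1) = insert (p (S n)) (S n ∪ (S n).powerset.biUnion (E n)) :=
    fun n => rfl
  refine ⟨S, fun n => ?_, fun n F hF => ?_⟩
  · rw [Finset.ssubset_iff, hS]
    exact ⟨p (S n), hp _, Finset.insert_subset_insert _ Finset.subset_union_left⟩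
  · rw [hS]
    refine Finset.Subset.trans ?_ (Finset.subset_insert _ _)
    exact (Finset.subset_biUnion_of_mem (E n) (Finset.mem_powerset.2 hF)).trans
      Finset.subset_union_right

open scoped Classical in
/-- If all functions equal to `g` on a finite set and to `v` elsewhere lie in each of the open
sets `V n`, then so does some function equal to `v` on a Gδ-set and to `g` elsewhere. -/
theorem exists_isGδ_forall_ite_mem {X : Type*} [TopologicalSpace X] [T1Space X]
    (hψ : ∀ x : X, IsGδ ({x} : Set X))
    (hΔ : ∀ Δ : ℕ → Set X, (∀ i, (Δ i).Finite ∧ (Δ i).Nonempty) →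
      (Pairwise fun i j => Disjoint (Δ i) (Δ j)) →
      ∃ φ : ℕ → ℕ, StrictMono φ ∧ IsGδ (⋃ k, Δ (φ k)))
    {A : Set X} {V : ℕ → Set (A → ℝ)} (hV : ∀ n, IsOpen (V n)) {g v : A → ℝ}
    (hgv : ∀ n, ∀ F : Finset A, (fun a => if a ∈ F then g a else v a) ∈ V n) :
    ∃ B : Set X, B.Countable ∧ IsGδ B ∧
      ∀ n, (fun a : A => if a.1 ∈ B then v a else g a) ∈ V n := by
  rcases A.finite_or_infinite with hA | hA
  · refine ⟨A, hA.countable, ?_, fun n => by simpa using hgv n ∅⟩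
    rw [← biUnion_of_singleton A]
    exact .biUnion hA fun x _ => hψ x
  have : Infinite A := hA.to_subtype
  choose E hE using fun n F => exists_finset_forall_eqOn_mem (hV n) (hgv n F)
  obtain ⟨S, hS, hSE⟩ := exists_ssubset_absorbing
    fun n F => (Finset.range (n + 1)).biUnion fun m => E m F
  have hmono : Monotone S := monotone_nat_of_le_succ fun n => (hS n).subset
  let D : ℕ → Finset A := fun n => S (n + 1) \ S n
  have hDdisj : ∀ i j, i < j → Disjoint (D i) (D j) := fun i j hij =>
    Finset.disjoint_left.2 fun a hi hj =>
      (Finset.mem_sdiff.1 hj).2 (hmono hij (Finset.mem_sdiff.1 hi).1)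
  obtain ⟨φ, hφ, hG⟩ := hΔ (fun n => Subtype.val '' (D n : Set A))
    (fun i => ⟨(D i).finite_toSet.image _,
      (Finset.coe_nonempty.2 (Finset.sdiff_nonempty.2 (hS i).not_subset)).image _⟩)
    (fun i j hij => by
      beta_reduce
      rw [Set.disjoint_image_iff Subtype.val_injective, Finset.disjoint_coe]
      rcases hij.lt_or_gt with h | h
      exacts [hDdisj i j h, (hDdisj j i h).symm])
  refine ⟨_, ?_, hG, fun n => ?_⟩
  · exact countable_iUnion fun k => (D (φ k)).countable_toSet.image _
  · set B : Set X := ⋃ k, Subtype.val '' (D (φ k) : Set A)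
    refine hE n ((S (φ n)).filter fun a => a.1 ∉ B) _ fun a ha => ?_
    have haS : a ∈ S (φ n + 1) := hSE (φ n) _ (Finset.filter_subset _ _)
      (Finset.mem_biUnion.2 ⟨n, by simpa using Nat.lt_succ_of_le (hφ.id_le n), ha⟩)
    by_cases haB : a.1 ∈ B
    · simp [haB]
    · have : a ∈ S (φ n) := by
        by_contra h
        exact haB (mem_iUnion.2 ⟨n, a, Finset.mem_coe.2 (Finset.mem_sdiff.2 ⟨haS, h⟩), rfl⟩)
      simp [haB, this]

theorem baireSpace_of_exists_subsequence_isGδ {X : Type*} [TopologicalSpace X] [T35Space X]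
    (hψ : ∀ x : X, IsGδ ({x} : Set X))
    (hΔ : ∀ Δ : ℕ → Set X, (∀ i, (Δ i).Finite ∧ (Δ i).Nonempty) →
      (Pairwise fun i j => Disjoint (Δ i) (Δ j)) →
      ∃ φ : ℕ → ℕ, StrictMono φ ∧ IsGδ (⋃ k, Δ (φ k))) :
    BaireSpace {f : X → ℝ // BaireOne f} := by
  classical
  refine ⟨fun W hWo hWd => dense_iff_inter_open.2 fun O hO ⟨f, hf⟩ => ?_⟩
  choose U hUo hUW using fun n => isOpen_induced_iff.1 (hWo n)
  obtain ⟨Q, hQ, rfl⟩ := isOpen_induced_iff.1 hO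
  have hUd : ∀ n, Dense (U n) := by
    refine fun n => dense_iff_inter_open.2 fun Q hQ hne => ?_
    obtain ⟨h, hh, hhQ⟩ := exists_continuous_mem hQ hne
    obtain ⟨q, hqQ, hqW⟩ := (hWd n).inter_open_nonempty _
      (hQ.preimage continuous_subtype_val) ⟨⟨h, .of_continuous hh⟩, hhQ⟩
    rw [← hUW] at hqW
    exact ⟨q.1, hqQ, hqW⟩
  obtain ⟨K, u, hu, huQ⟩ := isOpen_pi_iff.1 hQ f.1 hf
  obtain ⟨A, hA, hKA, V, hVo, hVd, hVU⟩ := exists_countable_support hUo hUd K.countable_toSet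
  have : Countable A := hA.to_subtype
  have hdense : Dense (⋂ i : ℕ × Finset A, {p : BoundedContinuousFunction X ℝ × (A → ℝ) |
      (fun a => if a ∈ i.2 then p.1 a else p.2 a) ∈ V i.1}) := by
    refine dense_iInter_of_isOpen (fun i => (hVo i.1).preimage ?_)
      fun i => dense_setOf_ite_mem (hVd i.1) i.2
    refine continuous_pi fun a => ?_
    split_ifs
    · exact (continuous_eval_const a.1).comp continuous_fst
    · fun_prop
  obtain ⟨g₀, hg₀, -⟩ := exists_interpolation K isOpen_univ (subset_univ _) f.1
  obtain ⟨⟨g, v⟩, hgvK, hgv⟩ := hdense.inter_open_nonempty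
    (⋂ x : K, {p | p.1 x.1 ∈ u x ∧ p.2 ⟨x.1, hKA x.2⟩ ∈ u x})
    (isOpen_iInter_of_finite fun x => by
      refine IsOpen.inter ((hu x x.2).1.preimage ?_) ((hu x x.2).1.preimage ?_)
      · exact (continuous_eval_const x.1).comp continuous_fst
      · fun_prop)
    ⟨(g₀, fun a => f.1 a), mem_iInter.2 fun x =>
      ⟨by simpa [hg₀ x x.2] using (hu x x.2).2, (hu x x.2).2⟩⟩
  obtain ⟨B, hBc, hBG, hBV⟩ := exists_isGδ_forall_ite_mem hψ hΔ hVo (g := fun a => g a)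
    (v := v) fun n F => mem_iInter.1 hgv (n, F)
  obtain ⟨v', hv'⟩ := exists_domRestrict_eq A v
  have hv'A : ∀ a : A, v' a = v a := fun a => congrFun hv' a
  refine ⟨⟨B.piecewise v' g, .piecewise_of_countable_isGδ hBc hBG v' g.continuous⟩,
    huQ fun x hx => ?_, mem_iInter.2 fun n => ?_⟩
  · have h := mem_iInter.1 hgvK ⟨x, hx⟩
    by_cases hxB : x ∈ B
    · simpa [hxB, hv'A ⟨x, hKA hx⟩] using h.2
    · simpa [hxB] using h.1
  · rw [← hUW]
    refine hVU n _ ?_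
    convert hBV n using 1
    ext a
    simp [Set.piecewise, hv'A]

/-- Let `X` be a Tychonoff space of countable pseudocharacter. Then
`B₁(X)` is Baire iff every pairwise disjoint sequence of nonempty finite subsets of `X`
has a subsequence whose union is a Gδ-set in `X`. -/
theorem statement11 {X : Type*} [TopologicalSpace X] [T35Space X]
    (hψ : ∀ x : X, IsGδ ({x} : Set X)) :
    BaireSpace {f : X → ℝ // BaireOne f} ↔
      ∀ Δ : ℕ → Set X,
        (∀ i, (Δ i).Finite ∧ (Δ i).Nonempty) →
        (Pairwise fun i j => Disjoint (Δ i) (Δ j)) →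
        ∃ φ : ℕ → ℕ, StrictMono φ ∧ IsGδ (⋃ k, Δ (φ k)) := by
  constructor
  · intro _ Δ hΔ hdisj
    exact exists_subsequence_isGδ_of_baireSpace hψ Δ (fun i => (hΔ i).1) hdisj
  · exact baireSpace_of_exists_subsequence_isGδ hψ
end

section
/- Let X be a metrizable topological space such that B_1(X) is a Baire space. Then for every countable subset A ⊆ X that is locally non-G_δ (no nonempty relatively open subset of A is a G_δ-set in X), there exists a pairwise disjoint family {B_i : i ∈ ℕ} of countable subsets of A such that A = ∪_{i∈ℕ} B_i, the closure of B_i in X equals the closure of A in X for every i, and each B_i is a G_δ-set in X. -/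
open Set Topology Filter

theorem BaireOne.update {X : Type*} [TopologicalSpace X] [TopologicalSpace.MetrizableSpace X]
    [DecidableEq X] {f : X → ℝ} (hf : BaireOne f) (b : X) (v : ℝ) :
    BaireOne (Function.update f b v) := by
  let := TopologicalSpace.metrizableSpaceMetric X
  obtain ⟨g, hg, hlim⟩ := hf
  refine ⟨fun n x => g n x + (v - f b) * max 0 (1 - n * dist x b), fun n => ?_, fun x => ?_⟩
  · have := hg n
    fun_prop
  · by_cases hx : x = b
    · subst hx
      simpa using (hlim x).add_const (v - f x)
    · rw [Function.update_of_ne hx]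
      refine (hlim x).congr' ?_
      obtain ⟨N, hN⟩ := exists_nat_gt (1 / dist x b)
      have hd : 0 < dist x b := dist_pos.2 hx
      filter_upwards [eventually_ge_atTop N] with n hn
      have h1 : 1 < (N : ℝ) * dist x b := (div_lt_iff₀ hd).1 hN
      have h2 : (N : ℝ) * dist x b ≤ n * dist x b := by gcongr
      rw [max_eq_left (by linarith)]
      simp

theorem BaireOne.isGδ_preimage {X : Type*} [TopologicalSpace X] {f : X → ℝ} (hf : BaireOne f)
    {C : Set ℝ} (hC : IsClosed C) : IsGδ (f ⁻¹' C) := by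
  rcases C.eq_empty_or_nonempty with rfl | hne
  · simp
  obtain ⟨g, hg, hlim⟩ := hf
  have hcont : Continuous fun y : ℝ => Metric.infDist y C := Metric.continuous_infDist_pt C
  have key : f ⁻¹' C =
      ⋂ k : ℕ, ⋂ N : ℕ, ⋃ n ≥ N, {x | Metric.infDist (g n x) C < 1 / ((k : ℝ) + 1)} := by
    ext x
    have hx := (hcont.tendsto (f x)).comp (hlim x)
    simp only [mem_preimage, mem_iInter, mem_iUnion, mem_ofPred_eq]
    rw [hC.mem_iff_infDist_zero hne]
    constructor
    · intro h k N
      rw [h] at hx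
      obtain ⟨n, hn, hlt⟩ := ((eventually_ge_atTop N).and
        (hx.eventually_lt_const (Nat.one_div_pos_of_nat (n := k)))).exists
      exact ⟨n, hn, hlt⟩
    · intro h
      by_contra hpos
      have hpos := lt_of_le_of_ne Metric.infDist_nonneg (Ne.symm hpos)
      obtain ⟨k, hk⟩ := exists_nat_one_div_lt hpos
      obtain ⟨N, hN⟩ := eventually_atTop.1 (hx.eventually_const_lt hk)
      obtain ⟨n, hn, hlt⟩ := h k N
      exact lt_asymm hlt (hN n hn)
  rw [key]
  refine .iInter fun k => .iInter fun N => IsOpen.isGδ ?_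
  exact isOpen_biUnion fun n _ => isOpen_lt (hcont.comp (hg n)) continuous_const

/-- The points of a countable set at which a Baire-one function is close to an injective
natural-valued labelling form a Gδ-set. -/
theorem BaireOne.isGδ_close_to_label {X : Type*} [TopologicalSpace X] [T1Space X]
    [FirstCountableTopology X] {f : X → ℝ} (hf : BaireOne f) {A : Set X} {c : X → ℕ}
    (hA : A.Countable) (hc : InjOn c A) : IsGδ {a ∈ A | |f a - c a| < 1 / 3} := by
  set B := {a ∈ A | |f a - c a| < 1 / 3}
  have hBA : B ⊆ A := fun a ha => ha.1
  let C : Set ℝ := Metric.cthickening (1 / 3) ((fun b => (c b : ℝ)) '' B)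
  have key : B = f ⁻¹' C ∩ ⋂ b ∈ B, (f ⁻¹' (Metric.ball (c b : ℝ) (1 / 2))ᶜ ∪ {b}) := by
    ext x
    simp only [mem_inter_iff, mem_preimage, mem_iInter, mem_union, mem_compl_iff,
      mem_singleton_iff]
    constructor
    · refine fun hx => ⟨Metric.thickening_subset_cthickening _ _
        (Metric.mem_thickening_iff.2 ⟨c x, mem_image_of_mem _ hx, hx.2⟩), fun b hb => ?_⟩
      by_cases hxb : x = b
      · exact Or.inr hxb
      refine Or.inl fun hball => ?_
      rw [Metric.mem_ball, Real.dist_eq, abs_lt] at hball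
      have hx2 := abs_lt.1 hx.2
      have hne : c x ≠ c b := fun h => hxb (hc hx.1 hb.1 h)
      rcases lt_or_gt_of_ne hne with h | h
      · have : (c x : ℝ) + 1 ≤ c b := by exact_mod_cast h
        linarith [hx2.2, hball.1]
      · have : (c b : ℝ) + 1 ≤ c x := by exact_mod_cast h
        linarith [hx2.1, hball.2]
    · rintro ⟨hxC, hx⟩
      obtain ⟨_, ⟨b, hb, rfl⟩, hd⟩ := Metric.mem_thickening_iff.1
        (Metric.cthickening_subset_thickening' (by norm_num) (by norm_num : (1 / 3 : ℝ) < 1 / 2)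
          _ hxC)
      rcases hx b hb with h | rfl
      · exact absurd hd h
      · exact hb
  rw [key]
  exact (hf.isGδ_preimage Metric.isClosed_cthickening).inter
    (.biInter (hA.mono hBA) fun b _ =>
      (hf.isGδ_preimage Metric.isOpen_ball.isClosed_compl).union (.singleton b))

theorem exists_isGδ_subset_dense {X : Type*} [TopologicalSpace X]
    [TopologicalSpace.MetrizableSpace X] [BaireSpace {f : X → ℝ // BaireOne f}] {A : Set X}
    (hA : A.Countable) (hinf : ∀ U : Set X, IsOpen U → (A ∩ U).Nonempty → (A ∩ U).Infinite) :
    ∃ B ⊆ A, IsGδ B ∧ A ⊆ closure B := by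
  classical
  let := TopologicalSpace.metrizableSpaceMetric X
  obtain ⟨c, hc⟩ := Set.countable_iff_exists_injOn.1 hA
  let G : A × ℕ → Set {f : X → ℝ // BaireOne f} := fun p =>
    ⋃ b ∈ A ∩ Metric.ball (p.1 : X) (1 / ((p.2 : ℝ) + 1)), {f | |f.1 b - c b| < 1 / 3}
  have hopen : ∀ p, IsOpen (G p) := fun p => isOpen_biUnion fun b _ =>
    isOpen_lt ((((continuous_apply b).comp continuous_subtype_val).sub continuous_const).abs)
      continuous_const
  have hdense : ∀ p, Dense (G p) := by
    refine fun p => dense_iff_inter_open.2 fun W hW hWne => ?_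
    obtain ⟨⟨f, hf⟩, hfW⟩ := hWne
    obtain ⟨V, hV, rfl⟩ := isOpen_induced_iff.1 hW
    obtain ⟨I, u, hu, hIV⟩ := isOpen_pi_iff.1 hV f hfW
    obtain ⟨b, hb, hbI⟩ := ((hinf _ Metric.isOpen_ball
      ⟨p.1, p.1.2, Metric.mem_ball_self Nat.one_div_pos_of_nat⟩).sdiff I.finite_toSet).nonempty
    refine ⟨⟨Function.update f b (c b), hf.update b _⟩, hIV fun a ha => ?_, ?_⟩
    · change Function.update f b _ a ∈ u a
      rw [Function.update_of_ne (ne_of_mem_of_not_mem (Finset.mem_coe.2 ha) hbI)]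
      exact (hu a ha).2
    · exact mem_biUnion hb (by simp)
  have : Countable A := hA.to_subtype
  have hne : Nonempty {f : X → ℝ // BaireOne f} :=
    ⟨⟨fun _ => 0, fun _ _ => 0, fun _ => continuous_const, fun _ => tendsto_const_nhds⟩⟩
  obtain ⟨f, hf⟩ := (dense_iInter_of_isOpen hopen hdense).nonempty
  refine ⟨_, sep_subset _ _, f.2.isGδ_close_to_label hA hc, fun a ha => ?_⟩
  refine Metric.mem_closure_iff.2 fun ε hε => ?_
  obtain ⟨n, hn⟩ := exists_nat_one_div_lt hε
  obtain ⟨b, hb, hfb⟩ := mem_iUnion₂.1 (mem_iInter.1 hf (⟨a, ha⟩, n))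
  exact ⟨b, ⟨hb.1, hfb⟩, (Metric.mem_ball'.1 hb.2).trans hn⟩

/-- No nonempty relatively open subset of `A` is a Gδ-set. -/
def LocallyNonGδ {X : Type*} [TopologicalSpace X] (A : Set X) : Prop :=
  ∀ U : Set X, IsOpen U → (A ∩ U).Nonempty → ¬ IsGδ (A ∩ U)

namespace LocallyNonGδ

variable {X : Type*} [TopologicalSpace X] {A B : Set X}

theorem subset_closure_diff [TopologicalSpace.MetrizableSpace X] (hA : LocallyNonGδ A)
    (hB : IsGδ B) (hBA : B ⊆ A) : A ⊆ closure (A \ B) := by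
  refine fun a ha => mem_closure_iff.2 fun U hU haU => ?_
  by_contra hemp
  refine hA U hU ⟨a, ha, haU⟩ ?_
  have : A ∩ U = B ∩ U := by
    refine Subset.antisymm (fun x hx => ⟨?_, hx.2⟩) (inter_subset_inter_left _ hBA)
    by_contra hxB
    exact hemp ⟨x, hx.2, hx.1, hxB⟩
  rw [this]
  exact hB.inter hU.isGδ

theorem diff (hA : LocallyNonGδ A) (hB : IsGδ B) (hBA : B ⊆ A) : LocallyNonGδ (A \ B) := by
  intro U hU hne hG
  refine hA U hU (hne.mono (inter_subset_inter_left _ sdiff_subset)) ?_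
  have : A ∩ U = (A \ B) ∩ U ∪ B ∩ U := by
    rw [← union_inter_distrib_right, sdiff_union_of_subset hBA]
  rw [this]
  exact hG.union (hB.inter hU.isGδ)

theorem exists_isGδ_subset_dense [TopologicalSpace.MetrizableSpace X]
    [BaireSpace {f : X → ℝ // BaireOne f}] (hA : LocallyNonGδ A) (hAc : A.Countable) (e : X) :
    ∃ B ⊆ A, IsGδ B ∧ A ⊆ closure B ∧ (e ∈ A → e ∈ B) := by
  obtain ⟨B, hBA, hB, hcl⟩ := _root_.exists_isGδ_subset_dense hAc fun U hU hne hfin =>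
    hA U hU hne hfin.isGδ
  refine ⟨B ∪ A ∩ {e}, union_subset hBA inter_subset_left,
    hB.union ((finite_singleton e).subset inter_subset_right).isGδ,
    hcl.trans (closure_mono subset_union_left), fun he => Or.inr ⟨he, rfl⟩⟩

end LocallyNonGδ


/-- Let `X` be metrizable with `B₁(X)` Baire. Then every countable
locally non-Gδ set `A ⊆ X` splits into a pairwise disjoint family `(B i)` of countable
Gδ-subsets of `X`, each dense in `A` (i.e. `closure (B i) = closure A`), with
`A = ⋃ i, B i`. -/
theorem statement12 {X : Type*} [TopologicalSpace X] [TopologicalSpace.MetrizableSpace X]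
    (hB : BaireSpace {f : X → ℝ // BaireOne f})
    (A : Set X) (hAc : A.Countable)
    (hloc : ∀ U : Set X, IsOpen U → (A ∩ U).Nonempty → ¬ IsGδ (A ∩ U)) :
    ∃ B : ℕ → Set X,
      (Pairwise fun i j => Disjoint (B i) (B j)) ∧
      (∀ i, B i ⊆ A) ∧ (∀ i, (B i).Countable) ∧
      A = ⋃ i, B i ∧
      (∀ i, closure (B i) = closure A) ∧
      (∀ i, IsGδ (B i)) := by
  rcases isEmpty_or_nonempty X with hX | hX
  · exact ⟨fun _ => ∅, by simp [Pairwise], by simp, by simp, Subsingleton.elim _ _,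
      fun _ => congrArg closure (Subsingleton.elim _ _), by simp⟩
  obtain ⟨e, he⟩ := Set.countable_iff_exists_subset_range.1 hAc
  choose! F hFsub hFG hFcl hFmem using fun (R : Set X) (hR : LocallyNonGδ R ∧ R.Countable)
    (x : X) => hR.1.exists_isGδ_subset_dense hR.2 x
  let R : ℕ → Set X := fun n => Nat.rec A (fun k S => S \ F S (e k)) n
  have hsucc : ∀ n, R (n + 1) = R n \ F (R n) (e n) := fun _ => rfl
  have hR : ∀ n, (LocallyNonGδ (R n) ∧ (R n).Countable) ∧ A ⊆ closure (R n) := by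
    intro n
    induction n with
    | zero => exact ⟨⟨hloc, hAc⟩, subset_closure⟩
    | succ n ih =>
      obtain ⟨h, hcl⟩ := ih
      have hG := hFG (R n) h (e n)
      have hsub := hFsub (R n) h (e n)
      rw [hsucc]
      exact ⟨⟨h.1.diff hG hsub, h.2.mono sdiff_subset⟩,
        hcl.trans (closure_minimal (h.1.subset_closure_diff hG hsub) isClosed_closure)⟩
  have hanti : Antitone R := antitone_nat_of_succ_le fun n => sdiff_subset
  have hBR : ∀ n, F (R n) (e n) ⊆ R n := fun n => hFsub (R n) (hR n).1 (e n)
  have hBA : ∀ n, F (R n) (e n) ⊆ A := fun n => (hBR n).trans (hanti n.zero_le)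
  have hcover : ∀ n, ∀ a ∈ A, a ∉ R n → ∃ m, a ∈ F (R m) (e m) := by
    intro n a ha
    induction n with
    | zero => exact fun h => absurd ha h
    | succ n ih =>
      intro h
      rcases Classical.em (a ∈ R n) with hn | hn
      · exact ⟨n, by_contra fun hF => h ⟨hn, hF⟩⟩
      · exact ih hn
  refine ⟨fun n => F (R n) (e n), ?_, hBA, fun n => hAc.mono (hBA n), ?_, fun n => ?_,
    fun n => hFG (R n) (hR n).1 (e n)⟩
  · refine (pairwise_disjoint_on _).2 fun m n hmn => ?_
    exact disjoint_sdiff_right.mono_right ((hBR n).trans (hanti (Nat.succ_le_of_lt hmn)))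
  · refine Subset.antisymm (fun a ha => mem_iUnion.2 ?_) (iUnion_subset hBA)
    obtain ⟨n, rfl⟩ := he ha
    rcases Classical.em (e n ∈ R n) with hn | hn
    · exact ⟨n, hFmem (R n) (hR n).1 (e n) hn⟩
    · exact hcover n _ ha hn
  · refine Subset.antisymm (closure_mono (hBA n)) (closure_minimal ?_ isClosed_closure)
    exact (hR n).2.trans (closure_minimal (hFcl (R n) (hR n).1 (e n)) isClosed_closure)
end

section
/- Let X be a metrizable topological space such that B_1(X) is a Baire space. Then every separable subset Y ⊆ X without isolated points is meager in itself (i.e., Y with the subspace topology is the union of countably many closed sets with empty interior). -/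
open Set Topology Filter

/-- Baire-one functions are stable under adding a continuous function. -/
theorem BaireOne.add_continuous {X : Type*} [TopologicalSpace X] {f h : X → ℝ}
    (hf : BaireOne f) (hh : Continuous h) : BaireOne (fun x => f x + h x) := by
  obtain ⟨g, hg, hlim⟩ := hf
  exact ⟨fun n x => g n x + h x, fun n => (hg n).add hh,
    fun x => (hlim x).add tendsto_const_nhds⟩

/-- A Baire-one function is bounded on some nonempty relatively open subset of every
subspace that is not meager in itself. -/
theorem BaireOne.exists_isOpen_forall_abs_le {X : Type*} [TopologicalSpace X] {f : X → ℝ}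
    (hf : BaireOne f) {Y : Set X} (hY : ¬ IsMeagre (univ : Set Y)) :
    ∃ U : Set Y, IsOpen U ∧ U.Nonempty ∧ ∃ m : ℕ, ∀ y ∈ U, |f y| ≤ m := by
  obtain ⟨g, hg, hlim⟩ := hf
  let A : ℕ → Set Y := fun m => {y | ∀ n, |g n y| ≤ m}
  have hA : ∀ m, IsClosed (A m) := fun m => by
    simp only [A, ofPred_forall]
    exact isClosed_iInter fun n =>
      isClosed_le ((hg n).comp continuous_subtype_val).abs continuous_const
  have hcover : (⋃ m, A m) = univ := by
    refine eq_univ_of_forall fun y => ?_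
    obtain ⟨C, hC⟩ := (hlim y).abs.bddAbove_range
    obtain ⟨m, hm⟩ := exists_nat_ge C
    exact mem_iUnion.2 ⟨m, fun n => (hC (mem_range_self n)).trans hm⟩
  have hint : ∃ m, (interior (A m)).Nonempty := by
    by_contra! hempty
    apply hY
    rw [← hcover]
    exact isMeagre_iUnion fun m =>
      ((hA m).isNowhereDense_iff.2 (hempty m)).isMeagre
  obtain ⟨m, hm⟩ := hint
  refine ⟨interior (A m), isOpen_interior, hm, m, fun y hy => ?_⟩
  exact le_of_tendsto (hlim y).abs (Eventually.of_forall (interior_subset hy))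

/-- On an infinite set, a uniform bound is a closed condition with empty interior on the
space of Baire-one functions. -/
theorem interior_setOf_baireOne_abs_le_eq_empty {X : Type*} [TopologicalSpace X] [T4Space X]
    {s : Set X} (hs : s.Infinite) (m : ℝ) :
    interior {f : {f : X → ℝ // BaireOne f} | ∀ x ∈ s, |f.1 x| ≤ m} = ∅ := by
  refine eq_empty_of_forall_notMem fun f hf => ?_
  rw [mem_interior_iff_mem_nhds, nhds_subtype_eq_comap, mem_comap] at hf
  obtain ⟨t, ht, hts⟩ := hf
  rw [nhds_pi, Filter.mem_pi] at ht
  obtain ⟨I, hI, u, hu, hut⟩ := ht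
  obtain ⟨x, hxs, hxI⟩ := (hs.sdiff hI).nonempty
  obtain ⟨h, h0, h1, -⟩ := exists_continuous_zero_one_of_isClosed hI.isClosed
    (isClosed_singleton (x := x)) (disjoint_singleton_right.2 hxI)
  let c : ℝ := m + 1 + |f.1 x|
  have hmem := hts (a := ⟨fun z => f.1 z + c * h z,
    f.2.add_continuous (continuous_const.mul h.continuous)⟩) (hut fun i hi => by
      have : h i = 0 := h0 hi
      simpa [this] using mem_of_mem_nhds (hu i)) x hxs
  have hx : h x = 1 := h1 rfl
  simp only [hx, mul_one, c] at hmem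
  linarith [(abs_le.1 hmem).2, neg_abs_le (f.1 x)]

/-- A uniform bound on a set is a closed condition on the space of Baire-one functions. -/
theorem isClosed_setOf_baireOne_abs_le {X : Type*} [TopologicalSpace X] (s : Set X) (m : ℝ) :
    IsClosed {f : {f : X → ℝ // BaireOne f} | ∀ x ∈ s, |f.1 x| ≤ m} := by
  simp only [ofPred_forall]
  exact isClosed_biInter fun x _ =>
    isClosed_le ((continuous_apply x).comp continuous_subtype_val).abs continuous_const

/-- If `X` is metrizable and `B₁(X)` is a Baire space, then every
separable subset `Y ⊆ X` without isolated points is meager in itself. -/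
theorem statement13 {X : Type*} [TopologicalSpace X] [TopologicalSpace.MetrizableSpace X]
    (hB : BaireSpace {f : X → ℝ // BaireOne f})
    (Y : Set X) (hsep : TopologicalSpace.IsSeparable Y)
    (hni : ∀ y : Y, Filter.NeBot (nhdsWithin y ({y}ᶜ : Set Y))) :
    IsMeagre (Set.univ : Set Y) := by
  by_contra hY
  have := hsep.secondCountableTopology
  let B := TopologicalSpace.countableBasis Y
  have hB_basis : TopologicalSpace.IsTopologicalBasis B :=
    TopologicalSpace.isBasis_countableBasis Y
  have : Countable B := (TopologicalSpace.countable_countableBasis Y).to_subtype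
  let S : B × ℕ → Set {f : X → ℝ // BaireOne f} := fun p =>
    {f | ∀ x ∈ ((↑) '' p.1.1 : Set X), |f.1 x| ≤ p.2}
  have hcover : ⋃ p, S p = univ := by
    refine eq_univ_of_forall fun f => ?_
    obtain ⟨U, hU, ⟨y, hy⟩, m, hm⟩ := f.2.exists_isOpen_forall_abs_le hY
    obtain ⟨V, hV, -, hVU⟩ := hB_basis.exists_subset_of_mem_open hy hU
    refine mem_iUnion.2 ⟨(⟨V, hV⟩, m), ?_⟩
    rintro _ ⟨z, hz, rfl⟩
    exact hm z (hVU hz)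
  have : Nonempty {f : X → ℝ // BaireOne f} :=
    ⟨⟨fun _ => 0, fun _ _ => 0, fun _ => continuous_const, fun _ => tendsto_const_nhds⟩⟩
  obtain ⟨⟨⟨V, hV⟩, m⟩, hne⟩ := nonempty_interior_of_iUnion_of_closed
    (fun p => isClosed_setOf_baireOne_abs_le _ _) hcover
  obtain ⟨y, hy⟩ := TopologicalSpace.nonempty_of_mem_countableBasis hV
  have := hni y
  have hVinf : V.Infinite := infinite_of_mem_nhds y ((hB_basis.isOpen hV).mem_nhds hy)
  exact hne.ne_empty
    (interior_setOf_baireOne_abs_le_eq_empty (hVinf.image Subtype.val_injective.injOn) m)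
end

section
/- Let X be a separable metrizable topological space without isolated points such that B_1(X) is a Baire space. Then X is meager in itself. -/
open Set Topology Filter

/-- In a metric space without isolated points, the Baire-one functions exceeding a given bound
somewhere on a given nonempty open set are dense. -/
theorem dense_baireOne_exceeding {X : Type*} [MetricSpace X]
    (hni : ∀ x : X, (𝓝[≠] x).NeBot) {U : Set X} (hU : IsOpen U) (hne : U.Nonempty) (c : ℝ) :
    Dense {f : {f : X → ℝ // BaireOne f} | ∃ x ∈ U, c < f.1 x} := by
  intro f
  obtain ⟨p, hp⟩ := hne
  have := hni p
  let tent : X → X → ℝ := fun x y => max 0 (1 - 2 * dist y x / dist x p)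
  have htent : ∀ x, Continuous fun y => (c + 1 - f.1 x) * tent x y := fun x => by
    dsimp only [tent]
    fun_prop
  refine mem_closure_of_tendsto
    (f := fun x => (⟨_, f.2.add_continuous (htent x)⟩ : {f : X → ℝ // BaireOne f}))
    (b := 𝓝[≠] p) ?_ ?_
  · rw [tendsto_subtype_rng, tendsto_pi_nhds]
    intro y
    have hfar : ∀ᶠ x in 𝓝[≠] p, dist x p ≤ 2 * dist y x := by
      by_cases hy : y = p
      · subst hy
        filter_upwards with x
        rw [dist_comm y x]
        linarith [dist_nonneg (x := x) (y := y)]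
      · have h : ∀ᶠ x in 𝓝 p, dist x p < 2 * dist y x := by
          refine (isOpen_lt (by fun_prop) (by fun_prop)).mem_nhds ?_
          simpa using hy
        exact (h.filter_mono nhdsWithin_le_nhds).mono fun x hx => hx.le
    refine tendsto_nhds_of_eventually_eq ?_
    filter_upwards [hfar, self_mem_nhdsWithin] with x hx hxp
    have hd : 0 < dist x p := dist_pos.2 hxp
    have : 1 ≤ 2 * dist y x / dist x p := by rwa [one_le_div hd]
    have hzero : tent x y = 0 := max_eq_left (by linarith)
    simp [hzero]
  · filter_upwards [nhdsWithin_le_nhds (hU.mem_nhds hp)] with x hx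
    refine ⟨x, hx, ?_⟩
    simp [tent]

/-- A space carrying a Baire-one function that is unbounded above on every nonempty open set is
meagre in itself. -/
theorem BaireOne.isMeagre_univ {X : Type*} [TopologicalSpace X] {f : X → ℝ} (hf : BaireOne f)
    (hub : ∀ U : Set X, IsOpen U → U.Nonempty → ∀ m : ℕ, ∃ x ∈ U, (m : ℝ) < f x) :
    IsMeagre (univ : Set X) := by
  obtain ⟨g, hg, hlim⟩ := hf
  have hcover : (univ : Set X) ⊆ ⋃ m : ℕ, {x | ∀ n, g n x ≤ m} := by
    intro x _
    obtain ⟨b, hb⟩ := (hlim x).bddAbove_range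
    obtain ⟨m, hm⟩ := exists_nat_ge b
    exact mem_iUnion.2 ⟨m, fun n => (hb (mem_range_self n)).trans hm⟩
  refine (isMeagre_iUnion fun m => IsNowhereDense.isMeagre ?_).mono hcover
  have hclosed : IsClosed {x | ∀ n, g n x ≤ m} := by
    simp only [ofPred_forall]
    exact isClosed_iInter fun n => isClosed_le (hg n) continuous_const
  rw [hclosed.isNowhereDense_iff]
  by_contra hint
  obtain ⟨x, hx, hlt⟩ := hub _ isOpen_interior (nonempty_iff_ne_empty.2 hint) m
  exact hlt.not_ge (le_of_tendsto' (hlim x) (interior_subset hx))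

/-- If `X` is a separable metrizable space without isolated points
and `B₁(X)` is a Baire space, then `X` is meager in itself. -/
theorem statement14 {X : Type*} [TopologicalSpace X] [TopologicalSpace.MetrizableSpace X]
    [TopologicalSpace.SeparableSpace X]
    (hni : ∀ x : X, Filter.NeBot (nhdsWithin x ({x}ᶜ : Set X)))
    (hB : BaireSpace {f : X → ℝ // BaireOne f}) :
    IsMeagre (Set.univ : Set X) := by
  let _ := TopologicalSpace.metrizableSpaceMetric X
  have : SecondCountableTopology X := UniformSpace.secondCountable_of_separable X
  let B := TopologicalSpace.countableBasis X
  have hdense : Dense (⋂ q : B × ℕ,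
      {f : {f : X → ℝ // BaireOne f} | ∃ x ∈ q.1.1, (q.2 : ℝ) < f.1 x}) := by
    have : Countable B := (TopologicalSpace.countable_countableBasis X).to_subtype
    refine dense_iInter_of_isOpen (fun q => ?_) fun q => dense_baireOne_exceeding hni
      (TopologicalSpace.isOpen_of_mem_countableBasis q.1.2)
      (TopologicalSpace.nonempty_of_mem_countableBasis q.1.2) q.2
    simp only [← exists_prop, ofPred_exists]
    exact isOpen_iUnion fun x => isOpen_iUnion fun _ =>
      isOpen_lt continuous_const ((continuous_apply x).comp continuous_subtype_val)
  have : Nonempty {f : X → ℝ // BaireOne f} :=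
    ⟨⟨fun _ => 0, fun _ _ => 0, fun _ => continuous_const, fun _ => tendsto_const_nhds⟩⟩
  obtain ⟨f, hf⟩ := hdense.nonempty
  simp only [mem_iInter] at hf
  refine f.2.isMeagre_univ fun V hV hne m => ?_
  obtain ⟨p, hp⟩ := hne
  obtain ⟨U, hU, -, hUV⟩ :=
    (TopologicalSpace.isBasis_countableBasis X).exists_subset_of_mem_open hp hV
  obtain ⟨x, hx, hlt⟩ := hf (⟨U, hU⟩, m)
  exact ⟨x, hUV hx, hlt⟩
end

section
/- Let X ⊆ ℝ be a Luzin set, i.e., X is uncountable and for every countable dense subset D of ℝ and every open set G ⊆ ℝ with D ⊆ G, the set X \ G is countable. Then B_1(X) (where X carries the subspace topology from ℝ) is meager in itself. -/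
open Set Topology Filter

/-- A nowhere dense set meets a set concentrated on every countable dense set in a countable set. -/
theorem countable_inter_of_isNowhereDense {X : Set ℝ}
    (hconc : ∀ D : Set ℝ, D.Countable → Dense D →
      ∀ G : Set ℝ, IsOpen G → D ⊆ G → (X \ G).Countable)
    {E : Set ℝ} (hE : IsNowhereDense E) : (X ∩ E).Countable := by
  have hdense : Dense (closure E)ᶜ := interior_eq_empty_iff_dense_compl.mp hE
  obtain ⟨D, hDG, hDc, hD⟩ := hdense.exists_countable_dense_subset
  refine (hconc D hDc hD _ isClosed_closure.isOpen_compl hDG).mono ?_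
  rintro x ⟨hxX, hxE⟩
  exact ⟨hxX, fun h => h (subset_closure hxE)⟩

/-- A Baire-one function on a Luzin set is bounded on an infinite trace of a basic open set. -/
theorem BaireOne.exists_bounded_on_infinite {X : Set ℝ} (hunc : ¬ X.Countable)
    (hconc : ∀ D : Set ℝ, D.Countable → Dense D →
      ∀ G : Set ℝ, IsOpen G → D ⊆ G → (X \ G).Countable)
    {f : X → ℝ} (hf : BaireOne f) :
    ∃ B ∈ TopologicalSpace.countableBasis ℝ, ((↑) ⁻¹' B : Set X).Infinite ∧
      ∃ m : ℕ, ∀ x : X, (x : ℝ) ∈ B → |f x| ≤ m := by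
  obtain ⟨g, hg, hlim⟩ := hf
  set E : ℕ → Set X := fun m => {x | ∀ n, |g n x| ≤ m} with hEdef
  have hEclosed : ∀ m, IsClosed (E m) := fun m => by
    simp only [hEdef, ofPred_forall]
    exact isClosed_iInter fun n => isClosed_le (hg n).abs continuous_const
  have hcover : ∀ x, ∃ m, x ∈ E m := fun x => by
    obtain ⟨C, hC⟩ := (hlim x).abs.bddAbove_range
    obtain ⟨m, hm⟩ := exists_nat_ge C
    exact ⟨m, fun n => (hC ⟨n, rfl⟩).trans hm⟩
  obtain ⟨m, hm⟩ : ∃ m, ¬ IsNowhereDense ((↑) '' E m : Set ℝ) := by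
    by_contra! h
    refine hunc ((countable_iUnion fun m =>
      countable_inter_of_isNowhereDense hconc (h m)).mono fun x hx => ?_)
    obtain ⟨m, hm⟩ := hcover ⟨x, hx⟩
    exact mem_iUnion.mpr ⟨m, hx, ⟨x, hx⟩, hm, rfl⟩
  obtain ⟨y, hy⟩ := nonempty_iff_ne_empty.mpr hm
  obtain ⟨B, hB, hyB, hBE⟩ := (TopologicalSpace.isBasis_countableBasis ℝ).exists_subset_of_mem_open
    hy isOpen_interior
  have hBopen := TopologicalSpace.isOpen_of_mem_countableBasis hB
  refine ⟨B, hB, fun hfin => ?_, m, fun x hx => ?_⟩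
  · have hdense : B ⊆ closure (B ∩ (↑) '' E m) := fun z hz =>
      hBopen.inter_closure ⟨hz, interior_subset (hBE hz)⟩
    have hfin' : (B ∩ (↑) '' E m).Finite := (hfin.image (↑)).subset <| by
      rintro _ ⟨hz, x, -, rfl⟩
      exact ⟨x, hz, rfl⟩
    rw [hfin'.isClosed.closure_eq] at hdense
    exact (infinite_of_mem_nhds y (hBopen.mem_nhds hyB)) (hfin'.subset hdense)
  · have hxE : x ∈ E m := by
      rw [← (hEclosed m).closure_eq, closure_subtype]
      exact interior_subset (hBE hx)
    exact le_of_tendsto (hlim x).abs (Eventually.of_forall hxE)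

/-- Baire-one functions bounded by a constant on an infinite set form a nowhere dense set. -/
theorem isNowhereDense_baireOne_bounded_on {X S : Set ℝ} (hS : ((↑) ⁻¹' S : Set X).Infinite)
    (c : ℝ) :
    IsNowhereDense {f : {f : X → ℝ // BaireOne f} | ∀ x : X, (x : ℝ) ∈ S → |f.1 x| ≤ c} := by
  have hclosed : IsClosed
      {f : {f : X → ℝ // BaireOne f} | ∀ x : X, (x : ℝ) ∈ S → |f.1 x| ≤ c} := by
    simp only [ofPred_forall]
    exact isClosed_iInter fun x => isClosed_iInter fun _ =>
      isClosed_le ((continuous_apply x).comp continuous_subtype_val).abs continuous_const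
  rw [hclosed.isNowhereDense_iff, eq_empty_iff_forall_notMem]
  intro f hf
  obtain ⟨U, hU, hUeq⟩ := isOpen_induced_iff.mp (isOpen_interior (s :=
    {f : {f : X → ℝ // BaireOne f} | ∀ x : X, (x : ℝ) ∈ S → |f.1 x| ≤ c}))
  have hfU : f.1 ∈ U := by
    rw [← hUeq] at hf
    exact hf
  obtain ⟨I, u, hu, hIU⟩ := isOpen_pi_iff.mp hU f.1 hfU
  obtain ⟨x, hxS, hxI⟩ := hS.exists_notMem_finset I
  set p : X → ℝ := fun y => ∏ s ∈ I, ((y : ℝ) - s)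
  have hpx : p x ≠ 0 := Finset.prod_ne_zero_iff.mpr fun s hs h =>
    hxI (by rwa [Subtype.ext (sub_eq_zero.mp h)])
  have hpI : ∀ s ∈ I, p s = 0 := fun s hs => Finset.prod_eq_zero hs (sub_self _)
  have hpcont : Continuous p := by fun_prop
  set a : ℝ := (c + 1 - f.1 x) / p x with ha
  let g : {f : X → ℝ // BaireOne f} :=
    ⟨fun y => f.1 y + a * p y, f.2.add_continuous (continuous_const.mul hpcont)⟩
  have hgU : g.1 ∈ U := hIU fun s hs => by
    simpa [g, hpI s hs] using (hu s hs).2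
  have hgint : g ∈ Subtype.val ⁻¹' U := hgU
  rw [hUeq] at hgint
  have hle : |f.1 x + a * p x| ≤ c := interior_subset hgint x hxS
  rw [ha, div_mul_cancel₀ _ hpx, add_sub_cancel] at hle
  linarith [le_abs_self (c + 1)]

/-- If `X ⊆ ℝ` is a Luzin set (uncountable and concentrated on every
countable dense subset of `ℝ`), then `B₁(X)` is meager in itself. -/
theorem statement16 (X : Set ℝ) (hunc : ¬ X.Countable)
    (hconc : ∀ D : Set ℝ, D.Countable → Dense D →
      ∀ G : Set ℝ, IsOpen G → D ⊆ G → (X \ G).Countable) :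
    IsMeagre (Set.univ : Set {f : X → ℝ // BaireOne f}) := by
  let J := {B : TopologicalSpace.countableBasis ℝ // ((↑) ⁻¹' (B : Set ℝ) : Set X).Infinite}
  have hmeagre := isMeagre_iUnion fun i : J × ℕ =>
    (isNowhereDense_baireOne_bounded_on i.1.2 (i.2 : ℝ)).isMeagre
  refine hmeagre.mono fun f _ => ?_
  obtain ⟨B, hB, hinf, m, hm⟩ := f.2.exists_bounded_on_infinite hunc hconc
  exact mem_iUnion.mpr ⟨(⟨⟨B, hB⟩, hinf⟩, m), hm⟩
end

section
/- Let X be a Tychonoff (completely regular Hausdorff) topological space. Then B_1(X) is ω-full in ℝ^X (every real-valued function defined on a countable subset Z ⊆ X extends to a Baire-one function on X) if and only if every countable subset of X is strongly Coz_δ-disjoint. -/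
open Set Topology Filter

theorem IsZeroSet.iInter {X : Type*} [TopologicalSpace X] {s : ℕ → Set X}
    (hs : ∀ n, IsZeroSet (s n)) : IsZeroSet (⋂ n, s n) := by
  choose f hf hsf using hs
  have hnonneg (x : X) (n : ℕ) : 0 ≤ (1 / 2 : ℝ) ^ n * min 1 |f n x| := by positivity
  have hle (n : ℕ) (x : X) : (1 / 2 : ℝ) ^ n * min 1 |f n x| ≤ (1 / 2) ^ n :=
    mul_le_of_le_one_right (by positivity) (min_le_left _ _)
  refine ⟨fun x => ∑' n, (1 / 2 : ℝ) ^ n * min 1 |f n x|, ?_, ?_⟩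
  · refine continuous_tsum (fun n => ?_) summable_geometric_two fun n x => ?_
    · have := hf n
      fun_prop
    · rw [Real.norm_of_nonneg (hnonneg x n)]
      exact hle n x
  · ext x
    have hsum : Summable fun n => (1 / 2 : ℝ) ^ n * min 1 |f n x| :=
      summable_geometric_two.of_nonneg_of_le (hnonneg x) fun n => hle n x
    have key : ∀ n, (1 / 2 : ℝ) ^ n * min 1 |f n x| = 0 ↔ f n x = 0 := fun n => by
      constructor
      · intro h
        rcases mul_eq_zero.1 h with h | h
        · exact absurd h (by positivity)
        · by_contra hne
          have : 0 < min 1 |f n x| := lt_min one_pos (abs_pos.2 hne)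
          exact this.ne' h
      · intro h
        simp [h]
    rw [mem_preimage, mem_singleton_iff, ← hsum.hasSum_iff,
      hasSum_zero_iff_of_nonneg (hnonneg x), funext_iff]
    simp only [hsf, mem_iInter, mem_preimage, mem_singleton_iff, Pi.zero_apply, key]

theorem BaireOne.isCozDelta_preimage_Iic_zero {X : Type*} [TopologicalSpace X] {h : X → ℝ}
    (hh : BaireOne h) : IsCozDelta (h ⁻¹' Iic 0) := by
  obtain ⟨g, hg, hlim⟩ := hh
  refine ⟨fun m => (⋂ n, {x | 1 / ((m : ℝ) + 1) ≤ g (n + m) x})ᶜ, fun m => ?_, ?_⟩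
  · rw [IsCozeroSet, compl_compl]
    refine IsZeroSet.iInter fun n => ⟨fun x => max 0 (1 / ((m : ℝ) + 1) - g (n + m) x), ?_, ?_⟩
    · have := hg (n + m)
      fun_prop
    · ext x
      simp
  · ext x
    simp only [mem_preimage, mem_Iic, mem_iInter, mem_compl_iff, mem_ofPred_eq, not_forall, not_le]
    constructor
    · intro hx m
      have hpos : h x < 1 / ((m : ℝ) + 1) := hx.trans_lt (by positivity)
      obtain ⟨N, hN⟩ := eventually_atTop.1 ((hlim x).eventually_lt_const hpos)
      exact ⟨N, hN _ (Nat.le_add_right _ _)⟩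
    · intro hx
      by_contra! hpos
      obtain ⟨N, hN⟩ := eventually_atTop.1 ((hlim x).eventually_const_lt (half_lt_self hpos))
      obtain ⟨M, hM⟩ := exists_nat_one_div_lt (half_pos hpos)
      obtain ⟨n, hn⟩ := hx (max M N)
      have h1 := hN (n + max M N) (by omega)
      have h2 : 1 / (((max M N : ℕ) : ℝ) + 1) ≤ 1 / ((M : ℝ) + 1) :=
        one_div_le_one_div_of_le (by positivity) (by gcongr; exact le_max_left _ _)
      linarith

theorem BaireOne.comp_continuous_s19 {X : Type*} [TopologicalSpace X] {h : X → ℝ}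
    (hh : BaireOne h) {φ : ℝ → ℝ} (hφ : Continuous φ) : BaireOne (φ ∘ h) := by
  obtain ⟨g, hg, hlim⟩ := hh
  exact ⟨fun n => φ ∘ g n, fun n => hφ.comp (hg n),
    fun x => (hφ.tendsto _).comp (hlim x)⟩

theorem BaireOne.isCozDelta_preimage {X : Type*} [TopologicalSpace X] {h : X → ℝ}
    (hh : BaireOne h) {C : Set ℝ} (hC : IsClosed C) : IsCozDelta (h ⁻¹' C) := by
  rcases C.eq_empty_or_nonempty with rfl | hne
  · have := (hh.comp_continuous_s19 (continuous_const (y := (1 : ℝ)))).isCozDelta_preimage_Iic_zero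
    convert this using 1
    ext x
    simp
  · have := (hh.comp_continuous_s19 (Metric.continuous_infDist_pt C)).isCozDelta_preimage_Iic_zero
    convert this using 1
    ext x
    rw [mem_preimage, mem_preimage, mem_Iic, Function.comp_apply,
      hC.mem_iff_infDist_zero hne]
    exact ⟨fun h => h.le, fun h => h.antisymm Metric.infDist_nonneg⟩

/-- If countably many zero-sets `h i ⁻¹' {0}` cover the space, the function taking the value `c i`
at the points whose first zero-set in the cover is the `i`-th one is Baire-one. -/
theorem exists_baireOne_eq_first {X : Type*} [TopologicalSpace X] {h : ℕ → X → ℝ}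
    (hh : ∀ i, Continuous (h i)) (hcov : ∀ x, ∃ i, h i x = 0) (c : ℕ → ℝ) :
    ∃ g : X → ℝ, BaireOne g ∧ ∀ x, ∃ i, h i x = 0 ∧ g x = c i := by
  classical
  let t : ℕ → ℕ → X → ℝ := fun k i x => max 0 (1 - k * |h i x|)
  refine ⟨fun x => c (Nat.find (hcov x)),
    ⟨fun k x => ∑ i ∈ Finset.range k, c i * (t k i x * ∏ j ∈ Finset.range i, (1 - t k j x)),
      fun k => ?_, fun x => ?_⟩, fun x => ⟨_, Nat.find_spec (hcov x), rfl⟩⟩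
  · have ht : ∀ i, Continuous (t k i) := fun i => by
      have := hh i
      fun_prop
    fun_prop
  · set i := Nat.find (hcov x) with hi
    have hti : ∀ k, t k i x = 1 := fun k => by simp [t, hi, Nat.find_spec (hcov x)]
    have htj : ∀ j < i, ∀ᶠ k in atTop, t k j x = 0 := fun j hj => by
      have hpos : 0 < |h j x| := abs_pos.2 (Nat.find_min (hcov x) hj)
      filter_upwards [(tendsto_natCast_atTop_atTop.atTop_mul_const hpos).eventually_ge_atTop 1]
        with k hk
      exact max_eq_left (sub_nonpos.2 hk)
    have hev : ∀ᶠ k in atTop, ∀ j ∈ Finset.range i, t k j x = 0 :=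
      (Finset.eventually_all _).2 fun j hj => htj j (Finset.mem_range.1 hj)
    refine tendsto_const_nhds.congr' ?_
    filter_upwards [hev, eventually_gt_atTop i] with k hk hik
    rw [Finset.sum_eq_single_of_mem i (Finset.mem_range.2 hik), hti, one_mul,
      Finset.prod_eq_one fun j hj => by rw [hk j hj, sub_zero], mul_one]
    intro j _ hji
    rcases hji.lt_or_gt with hlt | hgt
    · simp [hk j (Finset.mem_range.2 hlt)]
    · rw [Finset.prod_eq_zero (Finset.mem_range.2 hgt) (by rw [hti, sub_self]), mul_zero, mul_zero]

theorem stronglyCozDeltaDisjoint_of_exists_baireOne {X : Type*} [TopologicalSpace X] {A : Set X}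
    (hA : A.Countable) (hext : ∀ f : A → ℝ, ∃ g : X → ℝ, BaireOne g ∧ ∀ a : A, g a = f a) :
    StronglyCozDeltaDisjoint A := by
  have := hA.to_subtype
  obtain ⟨e, he⟩ := exists_injective_nat A
  obtain ⟨g, hg, hge⟩ := hext fun a => e a
  have hclosed (S : Set ℕ) : IsClosed ((fun n : ℕ => (n : ℝ)) '' S) :=
    Nat.isClosedEmbedding_coe_real.isClosedMap _ (isClosed_discrete S)
  refine ⟨fun a => g ⁻¹' {(e a : ℝ)}, hge, fun a b hab => ?_,
    fun a => hg.isCozDelta_preimage isClosed_singleton, fun S => ?_⟩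
  · refine Disjoint.preimage g (disjoint_singleton.2 fun h => hab (he ?_))
    exact_mod_cast h
  · convert hg.isCozDelta_preimage (hclosed (e '' S)) using 1
    ext x
    simp [eq_comm]

theorem StronglyCozDeltaDisjoint.exists_baireOne {X : Type*} [TopologicalSpace X] {A : Set X}
    (hA : A.Countable) (hdisj : StronglyCozDeltaDisjoint A) (f : A → ℝ) :
    ∃ g : X → ℝ, BaireOne g ∧ ∀ a : A, g a = f a := by
  have := hA.to_subtype
  rcases isEmpty_or_nonempty A with hempty | ⟨⟨a₀⟩⟩
  · exact ⟨fun _ => 0, ⟨fun _ _ => 0, fun _ => continuous_const, fun _ => tendsto_const_nhds⟩,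
      fun a => hempty.elim a⟩
  have : Nonempty A := ⟨a₀⟩
  obtain ⟨F, hmem, hF, -, hadd⟩ := hdisj
  choose G hG hGF using fun a : A => hadd {a}ᶜ
  choose h hh hGh using hG
  have hzero (x : X) (a : A) : (∃ k, h a k x = 0) ↔ ∀ b, b ≠ a → x ∉ F b := by
    have h1 : (∃ k, h a k x = 0) ↔ x ∉ ⋂ k, G a k := by
      rw [mem_iInter, not_forall]
      exact exists_congr fun k => (Set.ext_iff.1 (hGh a k) x).symm
    rw [h1, ← hGF]
    simp
  obtain ⟨e, he⟩ := exists_surjective_nat (A × ℕ)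
  have hcov (x : X) : ∃ i, h (e i).1 (e i).2 x = 0 := by
    obtain ⟨a, ha⟩ : ∃ a, ∀ b, b ≠ a → x ∉ F b := by
      by_cases hx : ∃ a, x ∈ F a
      · obtain ⟨a, ha⟩ := hx
        exact ⟨a, fun b hb hxb => (hF hb).notMem_of_mem_left hxb ha⟩
      · exact ⟨a₀, fun b _ hb => hx ⟨b, hb⟩⟩
    obtain ⟨k, hk⟩ := (hzero x a).2 ha
    obtain ⟨i, hi⟩ := he (a, k)
    exact ⟨i, by rw [hi]; exact hk⟩
  obtain ⟨g, hg, hgc⟩ := exists_baireOne_eq_first (fun i => hh (e i).1 (e i).2) hcov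
    fun i => f (e i).1
  refine ⟨g, hg, fun a => ?_⟩
  obtain ⟨i, hi, hgi⟩ := hgc a
  have hia : a = (e i).1 := by
    by_contra hne
    exact (hzero a (e i).1).1 ⟨_, hi⟩ a hne (hmem a)
  rw [hgi, ← hia]

/-- For a Tychonoff space `X`, the family `B₁(X)` is ω-full in `ℝ^X`
(every real-valued function on a countable subset of `X` extends to a Baire-one function
on `X`) iff every countable subset of `X` is strongly Coz_δ-disjoint. -/
theorem statement19 {X : Type*} [TopologicalSpace X] [T35Space X] :
    (∀ Z : Set X, Z.Countable → ∀ f : Z → ℝ,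
        ∃ g : X → ℝ, BaireOne g ∧ ∀ z : Z, g z = f z) ↔
      ∀ A : Set X, A.Countable → StronglyCozDeltaDisjoint A := by
  exact ⟨fun h A hA => stronglyCozDeltaDisjoint_of_exists_baireOne hA (h A hA),
    fun h Z hZ => (h Z hZ).exists_baireOne hZ⟩
end
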